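/- Consider switched-system data as in the context, with symmetric positive definite matrices P_p ∈ ℝ^{d×d} and constants λ̌_p ∈ ℝ for p ∈ P (with λ̌_p > 0 for p ∈ P_S and λ̌_p ≤ 0 for p ∈ P_U) such that ⟨P_p exp(A_p s) ξ, exp(A_p s) ξ⟩ ≥ exp(−λ̌_p s) ⟨P_p ξ, ξ⟩ for all s ≥ 0 and ξ ∈ ℝ^d, and constants μ̌_{pq} > 0 for (p,q) ∈ E(P) such that ⟨P_q ξ, ξ⟩ ≥ μ̌_{pq} ⟨P_p ξ, ξ⟩ for all ξ ∈ ℝ^d. If liminf_{t→+∞} [ ν(t) · Σ_{(p,q)∈E(P)} (ln μ̌_{pq}) ρ_{pq}(t) − Σ_{p∈P_S} |λ̌_p| η_p(t) + Σ_{p∈P_U} |λ̌_p| η_p(t) ] > 0, then for every x₀ ≠ 0 the solution satisfies ‖x(t)‖ → +∞ as t → +∞. -/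

import Mathlib

open Matrix Filter

attribute [local instance] Matrix.linftyOpNormedRing Matrix.linftyOpNormedAlgebra

/-- `prodFlow A σ τ k` is the state-transition matrix
`exp(A_{σ(k-1)}(τ_k − τ_{k-1})) ⋯ exp(A_{σ_0}(τ_1 − τ_0))`. -/
noncomputable def prodFlow {d : ℕ} {P : Type*} (A : P → Matrix (Fin d) (Fin d) ℝ)
    (σ : ℕ → P) (τ : ℕ → ℝ) : ℕ → Matrix (Fin d) (Fin d) ℝ
  | 0 => 1
  | (k + 1) => NormedSpace.exp ((τ (k + 1) - τ k) • A (σ k)) * prodFlow A σ τ k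

/-- Counting transitions: summing over edges with multiplicity is summing along the path. -/
lemma sum_mul_card_transitions {P : Type*} [DecidableEq P] (E : Finset (P × P)) (σ : ℕ → P)
    (hσE : ∀ k, (σ k, σ (k + 1)) ∈ E) (w : P × P → ℝ) (n : ℕ) :
    ∑ e ∈ E, w e *
        (((Finset.range n).filter (fun i => σ i = e.1 ∧ σ (i + 1) = e.2)).card : ℝ) =
      ∑ i ∈ Finset.range n, w (σ i, σ (i + 1)) := by
  simp_rw [Finset.card_filter, Nat.cast_sum, Finset.mul_sum]
  rw [Finset.sum_comm]
  refine Finset.sum_congr rfl fun i _ => ?_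
  rw [Finset.sum_eq_single_of_mem _ (hσE i)]
  · simp
  · rintro ⟨p, q⟩ _ hne
    have : ¬(σ i = p ∧ σ (i + 1) = q) := fun h => hne (by rw [h.1, h.2])
    simp [this]

/-- A signed sum of activation times over stable and unstable indices is a sum along the path. -/
lemma sum_abs_activation {P : Type*} [Fintype P] [DecidableEq P] (PS PU : Finset P)
    (hpart : ∀ p, p ∈ PS ↔ p ∉ PU) (lam : P → ℝ) (hlamS : ∀ p ∈ PS, 0 < lam p)
    (hlamU : ∀ p ∈ PU, lam p ≤ 0) (σ : ℕ → P) (g : ℕ → ℝ) (n : ℕ) :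
    ∑ p ∈ PS, |lam p| * (∑ i ∈ Finset.range n, if σ i = p then g i else 0)
      - ∑ p ∈ PU, |lam p| * (∑ i ∈ Finset.range n, if σ i = p then g i else 0) =
      ∑ i ∈ Finset.range n, lam (σ i) * g i := by
  have hPS : PS = PUᶜ := by ext p; simp [hpart]
  have hS : ∑ p ∈ PS, |lam p| * (∑ i ∈ Finset.range n, if σ i = p then g i else 0) =
      ∑ p ∈ PUᶜ, lam p * (∑ i ∈ Finset.range n, if σ i = p then g i else 0) := by
    rw [← hPS]
    exact Finset.sum_congr rfl fun p hp => by rw [abs_of_pos (hlamS p hp)]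
  have hU : ∑ p ∈ PU, |lam p| * (∑ i ∈ Finset.range n, if σ i = p then g i else 0) =
      -∑ p ∈ PU, lam p * (∑ i ∈ Finset.range n, if σ i = p then g i else 0) := by
    rw [← Finset.sum_neg_distrib]
    exact Finset.sum_congr rfl fun p hp => by rw [abs_of_nonpos (hlamU p hp), neg_mul]
  rw [hS, hU, sub_neg_eq_add, Finset.sum_compl_add_sum]
  simp_rw [Finset.mul_sum]
  rw [Finset.sum_comm]
  simp

/-- Lower bound of the Lyapunov-like functions at the switching instants. -/
lemma exp_mul_le_quadForm_prodFlow {d : ℕ} {P : Type*} (A : P → Matrix (Fin d) (Fin d) ℝ)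
    (E : Finset (P × P)) (τ : ℕ → ℝ) (hτmono : StrictMono τ) (σ : ℕ → P)
    (hσE : ∀ k, (σ k, σ (k + 1)) ∈ E) (Pm : P → Matrix (Fin d) (Fin d) ℝ) (lam : P → ℝ)
    (hlam : ∀ p, ∀ s : ℝ, 0 ≤ s → ∀ ξ : Fin d → ℝ,
      Real.exp (-(lam p) * s) * ((Pm p).mulVec ξ ⬝ᵥ ξ) ≤
        (Pm p).mulVec ((NormedSpace.exp (s • A p)).mulVec ξ) ⬝ᵥ
          (NormedSpace.exp (s • A p)).mulVec ξ)
    (mu : P × P → ℝ) (hmupos : ∀ e ∈ E, 0 < mu e)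
    (hmu : ∀ e ∈ E, ∀ ξ : Fin d → ℝ,
      mu e * ((Pm e.1).mulVec ξ ⬝ᵥ ξ) ≤ (Pm e.2).mulVec ξ ⬝ᵥ ξ)
    (x : Fin d → ℝ) (k : ℕ) :
    Real.exp (∑ i ∈ Finset.range k, Real.log (mu (σ i, σ (i + 1)))
        - ∑ i ∈ Finset.range k, lam (σ i) * (τ (i + 1) - τ i))
        * ((Pm (σ 0)).mulVec x ⬝ᵥ x) ≤
      (Pm (σ k)).mulVec ((prodFlow A σ τ k).mulVec x) ⬝ᵥ (prodFlow A σ τ k).mulVec x := by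
  induction k with
  | zero => simp [prodFlow]
  | succ k ih =>
    have hs : 0 ≤ τ (k + 1) - τ k := sub_nonneg.2 (hτmono k.lt_succ_self).le
    have hpos := hmupos _ (hσE k)
    rw [prodFlow, ← mulVec_mulVec]
    refine le_trans ?_ (hmu _ (hσE k) _)
    refine le_trans ?_ (mul_le_mul_of_nonneg_left (hlam (σ k) _ hs _) hpos.le)
    refine le_trans (le_of_eq ?_) (mul_le_mul_of_nonneg_left
      (mul_le_mul_of_nonneg_left ih (Real.exp_pos _).le) hpos.le)
    rw [← mul_assoc, ← mul_assoc]
    congr 1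
    nth_rewrite 1 [← Real.exp_log hpos]
    rw [← Real.exp_add, ← Real.exp_add, Finset.sum_range_succ, Finset.sum_range_succ]
    congr 1
    ring

/-- Finitely many quadratic forms are uniformly bounded by the squared Euclidean norm. -/
lemma exists_quadForm_le {d : ℕ} {P : Type*} [Fintype P] (Pm : P → Matrix (Fin d) (Fin d) ℝ) :
    ∃ C : ℝ, 0 < C ∧ ∀ p, ∀ x : Fin d → ℝ,
      (Pm p).mulVec x ⬝ᵥ x ≤ C * ‖(WithLp.equiv 2 (Fin d → ℝ)).symm x‖ ^ 2 := by
  refine ⟨1 + ∑ p, ∑ i, ∑ j, |Pm p i j|, by positivity, fun p x => ?_⟩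
  set y := (WithLp.equiv 2 (Fin d → ℝ)).symm x
  have hy (i : Fin d) : |x i| ≤ ‖y‖ := PiLp.norm_apply_le y i
  have hle : ∑ i, ∑ j, |Pm p i j| ≤ 1 + ∑ p, ∑ i, ∑ j, |Pm p i j| := by
    have : ∑ i, ∑ j, |Pm p i j| ≤ ∑ p, ∑ i, ∑ j, |Pm p i j| :=
      Finset.single_le_sum (f := fun p => ∑ i, ∑ j, |Pm p i j|)
        (fun _ _ => by positivity) (Finset.mem_univ p)
    linarith
  refine le_trans ?_ (mul_le_mul_of_nonneg_right hle (sq_nonneg _))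
  simp only [mulVec, dotProduct, Finset.sum_mul]
  refine Finset.sum_le_sum fun i _ => Finset.sum_le_sum fun j _ => ?_
  calc Pm p i j * x j * x i ≤ |Pm p i j * x j * x i| := le_abs_self _
    _ = |Pm p i j| * (|x j| * |x i|) := by rw [abs_mul, abs_mul, mul_assoc]
    _ ≤ |Pm p i j| * ‖y‖ ^ 2 := by
      rw [sq]
      gcongr <;> exact hy _

/-- A real function with positive liminf is eventually bounded below by a positive constant. -/
lemma exists_pos_eventually_le_of_liminf_pos {α : Type*} {l : Filter α} {f : α → ℝ}
    (h : 0 < liminf f l) : ∃ a, 0 < a ∧ ∀ᶠ t in l, a ≤ f t := by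
  rw [liminf_eq] at h
  have hne : {a | ∀ᶠ t in l, a ≤ f t}.Nonempty := by
    by_contra hempty
    rw [Set.not_nonempty_iff_eq_empty.1 hempty, Real.sSup_empty] at h
    exact h.false
  obtain ⟨a, ha, hpos⟩ := exists_lt_of_lt_csSup hne h
  exact ⟨a, hpos, ha⟩

/-- **Theorem (destabilizing switching signals).**  If the liminf, as `t → +∞`, of
`ν(t) Σ_{(p,q)∈E} (ln μ̌_{pq}) ρ_{pq}(t) − Σ_{p∈P_S} |λ̌_p| η_p(t) + Σ_{p∈P_U} |λ̌_p| η_p(t)`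
is strictly positive, then the switched linear system is unstable: for every `x₀ ≠ 0`
the Euclidean norm of the solution diverges to `+∞`. -/
theorem destabilizing_switching
    {d : ℕ} {P : Type*} [Fintype P] [DecidableEq P]
    -- the partition P = P_S ⊔ P_U
    (PS PU : Finset P) (hpart : ∀ p, p ∈ PS ↔ p ∉ PU)
    -- subsystem matrices and admissible transitions
    (A : P → Matrix (Fin d) (Fin d) ℝ) (E : Finset (P × P))
    -- the switching signal: switching instants and active indices
    (τ : ℕ → ℝ) (hτ0 : τ 0 = 0) (hτmono : StrictMono τ)
    (hτtop : Tendsto τ atTop atTop)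
    (σ : ℕ → P) (hσE : ∀ k, (σ k, σ (k + 1)) ∈ E)
    -- N t = number of switching instants in (0, t]
    (N : ℝ → ℕ) (hN : ∀ t : ℝ, 0 ≤ t → ∀ k, (τ k ≤ t ↔ k ≤ N t))
    -- multiple Lyapunov-like functions: matrices P_p and constants λ̌_p
    (Pm : P → Matrix (Fin d) (Fin d) ℝ) (hPm : ∀ p, (Pm p).PosDef)
    (lam : P → ℝ) (hlamS : ∀ p ∈ PS, 0 < lam p) (hlamU : ∀ p ∈ PU, lam p ≤ 0)
    (hlam : ∀ p, ∀ s : ℝ, 0 ≤ s → ∀ ξ : Fin d → ℝ,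
      Real.exp (-(lam p) * s) * ((Pm p).mulVec ξ ⬝ᵥ ξ) ≤
        (Pm p).mulVec ((NormedSpace.exp (s • A p)).mulVec ξ) ⬝ᵥ
          (NormedSpace.exp (s • A p)).mulVec ξ)
    -- the constants μ̌_{pq}
    (mu : P × P → ℝ) (hmupos : ∀ e ∈ E, 0 < mu e)
    (hmu : ∀ e ∈ E, ∀ ξ : Fin d → ℝ,
      mu e * ((Pm e.1).mulVec ξ ⬝ᵥ ξ) ≤ (Pm e.2).mulVec ξ ⬝ᵥ ξ)
    -- the instability condition (liminf > 0)
    (hliminf : 0 < liminf (fun t : ℝ =>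
      (N t / t) * ∑ e ∈ E, Real.log (mu e) *
          (((Finset.range (N t)).filter (fun i => σ i = e.1 ∧ σ (i + 1) = e.2)).card / (N t : ℝ))
        - ∑ p ∈ PS, |lam p| *
            ((∑ i ∈ Finset.range (N t + 1),
              if σ i = p then min (τ (i + 1)) t - τ i else 0) / t)
        + ∑ p ∈ PU, |lam p| *
            ((∑ i ∈ Finset.range (N t + 1),
              if σ i = p then min (τ (i + 1)) t - τ i else 0) / t)) atTop) :
    -- conclusion: instability
    ∀ x₀ : Fin d → ℝ, x₀ ≠ 0 →
      Tendsto (fun t : ℝ => ‖(WithLp.equiv 2 (Fin d → ℝ)).symm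
          ((NormedSpace.exp ((t - τ (N t)) • A (σ (N t))) *
            prodFlow A σ τ (N t)).mulVec x₀)‖) atTop atTop := by
  intro x₀ hx₀
  obtain ⟨a, ha, hev⟩ := exists_pos_eventually_le_of_liminf_pos hliminf
  obtain ⟨C, hC, hbound⟩ := exists_quadForm_le Pm
  have hV : 0 < (Pm (σ 0)).mulVec x₀ ⬝ᵥ x₀ := by
    have := (hPm (σ 0)).dotProduct_mulVec_pos hx₀
    rwa [star_trivial, dotProduct_comm] at this
  set V := (Pm (σ 0)).mulVec x₀ ⬝ᵥ x₀
  have hlim : Tendsto (fun t : ℝ => √(Real.exp (a * t) * (V / C))) atTop atTop :=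
    Real.tendsto_sqrt_atTop.comp <| (Real.tendsto_exp_atTop.comp
      (tendsto_id.const_mul_atTop ha)).atTop_mul_const (div_pos hV hC)
  refine tendsto_atTop_mono' _ ?_ hlim
  filter_upwards [hev, eventually_gt_atTop 0] with t hat ht
  have hτN : τ (N t) ≤ t := (hN t ht.le _).2 le_rfl
  have hlt : t < τ (N t + 1) := by
    by_contra! h
    exact absurd ((hN t ht.le _).1 h) (by omega)
  have hsum : a * t ≤ ∑ i ∈ Finset.range (N t), Real.log (mu (σ i, σ (i + 1)))
      - ∑ i ∈ Finset.range (N t + 1), lam (σ i) * (min (τ (i + 1)) t - τ i) := by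
    rw [← sum_mul_card_transitions E σ hσE (fun e => Real.log (mu e)),
      ← sum_abs_activation PS PU hpart lam hlamS hlamU, ← le_div_iff₀ ht]
    refine hat.trans (le_of_eq ?_)
    simp_rw [← mul_div_assoc, ← Finset.sum_div]
    rcases eq_or_ne (N t) 0 with h0 | h0
    · simp only [h0, Finset.range_zero, Finset.filter_empty, Finset.card_empty,
        Nat.cast_zero, mul_zero, Finset.sum_const_zero]
      ring
    · have : (N t : ℝ) ≠ 0 := Nat.cast_ne_zero.2 h0
      field_simp
      ring
  have hmin : ∑ i ∈ Finset.range (N t + 1), lam (σ i) * (min (τ (i + 1)) t - τ i) =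
      ∑ i ∈ Finset.range (N t), lam (σ i) * (τ (i + 1) - τ i)
        + lam (σ (N t)) * (t - τ (N t)) := by
    rw [Finset.sum_range_succ, min_eq_right hlt.le]
    congr 1
    refine Finset.sum_congr rfl fun i hi => ?_
    rw [min_eq_left ((hN t ht.le _).2 (Finset.mem_range.1 hi))]
  refine Real.sqrt_le_iff.2 ⟨norm_nonneg _, ?_⟩
  rw [← mul_div_assoc, div_le_iff₀ hC, mul_comm _ C]
  refine le_trans ?_ (hbound (σ (N t)) _)
  rw [← mulVec_mulVec]
  refine le_trans ?_ (hlam _ _ (sub_nonneg.2 hτN) _)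
  refine le_trans ?_ (mul_le_mul_of_nonneg_left
    (exp_mul_le_quadForm_prodFlow A E τ hτmono σ hσE Pm lam hlam mu hmupos hmu x₀ (N t))
    (Real.exp_pos _).le)
  rw [← mul_assoc, ← Real.exp_add]
  refine mul_le_mul_of_nonneg_right (Real.exp_le_exp.2 ?_) hV.le
  linarith
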